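/- Fix q ∈ ℝ with q ≠ 0 and q² ≠ 1. Let Â₁, Â₂ : ℝ∖{0} → ℝ and define the operator Ŝ by (Ŝ f)(z) = Â₁(z) f(qz) + Â₂(z) f(q⁻¹z) for z ≠ 0. Then Ŝ maps, for every n ≥ 0, (the restriction to ℝ∖{0} of) every polynomial function of degree n to the restriction of a polynomial function of degree at most n+1 if and only if there exist real numbers a₀₀, a₀₁, a₁₀, a₁₁, a₁₂ such that for all z ≠ 0: Â₁(z) = [a₁₀ + (a₁₁ − a₀₀q⁻¹)z + (a₁₂ − a₀₁q⁻¹)z²] / ((q−q⁻¹)z) and Â₂(z) = [a₁₀ + (a₁₁ − a₀₀q)z + (a₁₂ − a₀₁q)z²] / ((q⁻¹−q)z); equivalently, if and only if Â₁(z)+Â₂(z) = a₀₀ + a₀₁z and qÂ₁(z)+q⁻¹Â₂(z) = a₁₀z⁻¹ + a₁₁ + a₁₂z for some reals a₀₀, a₀₁, a₁₀, a₁₁, a₁₂. In particular the space of such operators Ŝ is 5-dimensional. -/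

import Mathlib

open Polynomial

/-- The punctured real line `ℝ ∖ {0}`. -/
abbrev Nz : Type := {z : ℝ // z ≠ 0}

/-- The S-Heun candidate operator `Ŝ = Â₁ T̂₊ + Â₂ T̂₋` on the q-linear grid,
acting on functions on `ℝ ∖ {0}`. -/
noncomputable def ShatOp (q : ℝ) (hq : q ≠ 0) (A₁ A₂ : Nz → ℝ) (f : Nz → ℝ) : Nz → ℝ :=
  fun z => A₁ z * f ⟨q * (z : ℝ), mul_ne_zero hq z.2⟩ +
           A₂ z * f ⟨q⁻¹ * (z : ℝ), mul_ne_zero (inv_ne_zero hq) z.2⟩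

/-- `Ŝ` maps (the restriction to `ℝ ∖ {0}` of) every polynomial function of degree `n`
to the restriction of a polynomial function of degree at most `n+1`, for every `n ≥ 0`. -/
def ShatRaise (q : ℝ) (hq : q ≠ 0) (A₁ A₂ : Nz → ℝ) : Prop :=
  ∀ (n : ℕ) (p : ℝ[X]), p.degree = (n : WithBot ℕ) →
    ∃ r : ℝ[X], r.degree ≤ (n : WithBot ℕ) + 1 ∧
      ∀ z : Nz, ShatOp q hq A₁ A₂ (fun w => p.eval (w : ℝ)) z = r.eval (z : ℝ)

lemma qq_ne (q : ℝ) (hq : q ≠ 0) (hq2 : q ^ 2 ≠ 1) : q - q⁻¹ ≠ 0 := by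
  intro h
  apply hq2
  field_simp at h
  linarith

lemma pt_iff (q : ℝ) (hq : q ≠ 0) (hq2 : q ^ 2 ≠ 1) (A B a₀₀ a₀₁ a₁₀ a₁₁ a₁₂ z : ℝ) (hz : z ≠ 0) :
    (A = (a₁₀ + (a₁₁ - a₀₀ * q⁻¹) * z + (a₁₂ - a₀₁ * q⁻¹) * z^2) / ((q - q⁻¹) * z) ∧
     B = (a₁₀ + (a₁₁ - a₀₀ * q) * z + (a₁₂ - a₀₁ * q) * z^2) / ((q⁻¹ - q) * z)) ↔
    (A + B = a₀₀ + a₀₁ * z ∧ q * A + q⁻¹ * B = a₁₀ * z⁻¹ + a₁₁ + a₁₂ * z) := by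
  have h1 := qq_ne q hq hq2
  have h2 : q⁻¹ - q ≠ 0 := by
    intro h; apply h1; linarith
  have e : a₁₀ = a₁₀ * z⁻¹ * z := by field_simp
  rw [eq_div_iff (mul_ne_zero h1 hz), eq_div_iff (mul_ne_zero h2 hz)]
  have hqi : q * q⁻¹ = 1 := mul_inv_cancel₀ hq
  generalize q⁻¹ = p at *
  generalize z⁻¹ = w at *
  constructor
  · rintro ⟨hA, hB⟩
    constructor
    · apply mul_left_cancel₀ (mul_ne_zero h1 hz)
      linear_combination hA - hB
    · apply mul_left_cancel₀ (mul_ne_zero h1 hz)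
      linear_combination q * hA - p * hB + (q - p) * e
  · rintro ⟨hA, hB⟩
    constructor
    · linear_combination z * hB - p * z * hA - e
    · linear_combination z * hB - q * z * hA - e

lemma mono_img (q : ℝ) (hq : q ≠ 0) (A₁ A₂ : Nz → ℝ) (a₀₀ a₀₁ a₁₀ a₁₁ a₁₂ : ℝ)
    (h : ∀ z : Nz, A₁ z + A₂ z = a₀₀ + a₀₁ * (z : ℝ) ∧
        q * A₁ z + q⁻¹ * A₂ z = a₁₀ * (z : ℝ)⁻¹ + a₁₁ + a₁₂ * (z : ℝ)) (k : ℕ) :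
    ∃ r : ℝ[X], r.natDegree ≤ k + 1 ∧ ∀ z : Nz,
      A₁ z * (q * (z : ℝ)) ^ k + A₂ z * (q⁻¹ * (z : ℝ)) ^ k = r.eval (z : ℝ) := by
  induction k using Nat.twoStepInduction with
  | zero =>
    refine ⟨C a₀₀ + C a₀₁ * X, by compute_degree, fun z => ?_⟩
    simpa using (h z).1
  | one =>
    refine ⟨C a₁₀ + C a₁₁ * X + C a₁₂ * X ^ 2, by compute_degree, fun z => ?_⟩
    have e : (z : ℝ)⁻¹ * z = 1 := inv_mul_cancel₀ z.2
    simp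
    linear_combination (z : ℝ) * (h z).2 + a₁₀ * e
  | more k ih0 ih1 =>
    obtain ⟨r0, d0, h0⟩ := ih0
    obtain ⟨r1, d1, h1⟩ := ih1
    refine ⟨C (q + q⁻¹) * X * r1 - X ^ 2 * r0, ?_, fun z => ?_⟩
    · refine (natDegree_sub_le _ _).trans (max_le ?_ ?_)
      · refine natDegree_mul_le.trans ?_
        have : (C (q + q⁻¹) * X : ℝ[X]).natDegree ≤ 1 := by compute_degree
        omega
      · refine natDegree_mul_le.trans ?_
        have : (X ^ 2 : ℝ[X]).natDegree ≤ 2 := by compute_degree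
        omega
    · simp only [eval_sub, eval_mul, eval_C, eval_X, eval_pow, ← h0, ← h1]
      have hqi : q * q⁻¹ = 1 := mul_inv_cancel₀ hq
      generalize q⁻¹ = p at *
      simp only [mul_pow, pow_succ]
      linear_combination (-(A₁ z * q ^ k + A₂ z * p ^ k) * (z : ℝ) ^ k * (z : ℝ) ^ 2) * hqi

lemma raise_iff (q : ℝ) (hq : q ≠ 0) (A₁ A₂ : Nz → ℝ) :
    ShatRaise q hq A₁ A₂ ↔
      ∃ a₀₀ a₀₁ a₁₀ a₁₁ a₁₂ : ℝ, ∀ z : Nz,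
        A₁ z + A₂ z = a₀₀ + a₀₁ * (z : ℝ) ∧
        q * A₁ z + q⁻¹ * A₂ z = a₁₀ * (z : ℝ)⁻¹ + a₁₁ + a₁₂ * (z : ℝ) := by
  constructor
  · intro H
    obtain ⟨r, hr, hr'⟩ := H 0 1 (by simp)
    obtain ⟨s, hs, hs'⟩ := H 1 X (by simp)
    have dr : r.natDegree < 2 := by
      have : r.natDegree ≤ 1 := natDegree_le_iff_degree_le.2 (by simpa using hr)
      omega
    have ds : s.natDegree < 3 := by
      have : s.natDegree ≤ 2 := natDegree_le_iff_degree_le.2 (hs.trans (by norm_num [one_add_one_eq_two]))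
      omega
    refine ⟨r.coeff 0, r.coeff 1, s.coeff 0, s.coeff 1, s.coeff 2, fun z => ⟨?_, ?_⟩⟩
    · have := hr' z
      rw [eval_eq_sum_range' dr] at this
      simpa [ShatOp, Finset.sum_range_succ] using this
    · have := hs' z
      rw [eval_eq_sum_range' ds] at this
      simp [ShatOp, Finset.sum_range_succ] at this
      have e : (z : ℝ)⁻¹ * z = 1 := inv_mul_cancel₀ z.2
      apply mul_right_cancel₀ z.2
      linear_combination this - s.coeff 0 * e
  · rintro ⟨a₀₀, a₀₁, a₁₀, a₁₁, a₁₂, h⟩ n p hp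
    choose r dr hr using mono_img q hq A₁ A₂ a₀₀ a₀₁ a₁₀ a₁₁ a₁₂ h
    have hp' : p.natDegree < n + 1 := by
      rw [natDegree_eq_of_degree_eq_some hp]; omega
    refine ⟨∑ i ∈ Finset.range (n + 1), C (p.coeff i) * r i, ?_, fun z => ?_⟩
    · have : (∑ i ∈ Finset.range (n + 1), C (p.coeff i) * r i).natDegree ≤ n + 1 := by
        apply natDegree_sum_le_of_forall_le
        intro i hi
        have := Finset.mem_range.1 hi
        exact (natDegree_C_mul_le _ _).trans ((dr i).trans (by omega))
      exact_mod_cast natDegree_le_iff_degree_le.1 this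
    · simp only [ShatOp, eval_finset_sum, eval_mul, eval_C, ← hr, eval_eq_sum_range' hp',
        Finset.mul_sum, ← Finset.sum_add_distrib]
      refine Finset.sum_congr rfl fun i _ => ?_
      ring

/-- The parametrisation of the coefficient pairs. -/
noncomputable def paramMap (q : ℝ) : (Fin 5 → ℝ) →ₗ[ℝ] (Nz → ℝ) × (Nz → ℝ) where
  toFun a := (fun z => (a 2 + (a 3 - a 0 * q⁻¹) * (z : ℝ) + (a 4 - a 1 * q⁻¹) * (z : ℝ)^2) /
                 ((q - q⁻¹) * (z : ℝ)),
              fun z => (a 2 + (a 3 - a 0 * q) * (z : ℝ) + (a 4 - a 1 * q) * (z : ℝ)^2) /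
                 ((q⁻¹ - q) * (z : ℝ)))
  map_add' a b := by
    ext z <;> simp only [Pi.add_apply, Prod.fst_add, Prod.snd_add] <;> ring
  map_smul' c a := by
    ext z <;> simp only [Pi.smul_apply, Prod.smul_fst, Prod.smul_snd, smul_eq_mul,
      RingHom.id_apply] <;> ring

lemma raise_iff' (q : ℝ) (hq : q ≠ 0) (hq2 : q ^ 2 ≠ 1) (A₁ A₂ : Nz → ℝ) :
    ShatRaise q hq A₁ A₂ ↔
      ∃ a₀₀ a₀₁ a₁₀ a₁₁ a₁₂ : ℝ, ∀ z : Nz,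
        A₁ z = (a₁₀ + (a₁₁ - a₀₀ * q⁻¹) * (z : ℝ) + (a₁₂ - a₀₁ * q⁻¹) * (z : ℝ)^2) /
                 ((q - q⁻¹) * (z : ℝ)) ∧
        A₂ z = (a₁₀ + (a₁₁ - a₀₀ * q) * (z : ℝ) + (a₁₂ - a₀₁ * q) * (z : ℝ)^2) /
                 ((q⁻¹ - q) * (z : ℝ)) := by
  rw [raise_iff]
  constructor
  · rintro ⟨a, b, c, d, e, h⟩
    exact ⟨a, b, c, d, e, fun z => (pt_iff q hq hq2 _ _ a b c d e z z.2).2 (h z)⟩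
  · rintro ⟨a, b, c, d, e, h⟩
    exact ⟨a, b, c, d, e, fun z => (pt_iff q hq hq2 _ _ a b c d e z z.2).1 (h z)⟩

lemma paramMap_inj (q : ℝ) (hq : q ≠ 0) (hq2 : q ^ 2 ≠ 1) :
    Function.Injective (paramMap q) := by
  rw [← LinearMap.ker_eq_bot, LinearMap.ker_eq_bot']
  intro a ha
  have key : ∀ z : ℝ, z ≠ 0 → (0 : ℝ) + 0 = a 0 + a 1 * z ∧
      q * 0 + q⁻¹ * 0 = a 2 * z⁻¹ + a 3 + a 4 * z := by
    intro z hz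
    refine (pt_iff q hq hq2 0 0 (a 0) (a 1) (a 2) (a 3) (a 4) z hz).1 ⟨?_, ?_⟩
    · exact (congrFun (congrArg Prod.fst ha) ⟨z, hz⟩).symm
    · exact (congrFun (congrArg Prod.snd ha) ⟨z, hz⟩).symm
  have k1 := key 1 (by norm_num)
  have k2 := key (-1) (by norm_num)
  have k3 := key 2 (by norm_num)
  norm_num at k1 k2 k3
  obtain ⟨p1, s1⟩ := k1
  obtain ⟨p2, s2⟩ := k2
  obtain ⟨p3, s3⟩ := k3
  ext i
  fin_cases i <;> simp <;> linarith

lemma raise_set (q : ℝ) (hq : q ≠ 0) (hq2 : q ^ 2 ≠ 1) :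
    {P : (Nz → ℝ) × (Nz → ℝ) | ShatRaise q hq P.1 P.2} = (LinearMap.range (paramMap q) : Set _) := by
  ext ⟨A₁, A₂⟩
  simp only [Set.mem_setOf_eq, SetLike.mem_coe, LinearMap.mem_range]
  rw [raise_iff' q hq hq2]
  constructor
  · rintro ⟨a, b, c, d, e, h⟩
    refine ⟨![a, b, c, d, e], ?_⟩
    refine Prod.ext (funext fun z => ?_) (funext fun z => ?_)
    · exact ((h z).1).symm
    · exact ((h z).2).symm
  · rintro ⟨a, h⟩
    refine ⟨a 0, a 1, a 2, a 3, a 4, fun z => ⟨?_, ?_⟩⟩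
    · exact (congrFun (congrArg Prod.fst h) z).symm
    · exact (congrFun (congrArg Prod.snd h) z).symm

theorem stmt_1 (q : ℝ) (hq : q ≠ 0) (hq2 : q ^ 2 ≠ 1) (A₁ A₂ : Nz → ℝ) :
    (ShatRaise q hq A₁ A₂ ↔
      ∃ a₀₀ a₀₁ a₁₀ a₁₁ a₁₂ : ℝ, ∀ z : Nz,
        A₁ z = (a₁₀ + (a₁₁ - a₀₀ * q⁻¹) * (z : ℝ) + (a₁₂ - a₀₁ * q⁻¹) * (z : ℝ)^2) /
                 ((q - q⁻¹) * (z : ℝ)) ∧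
        A₂ z = (a₁₀ + (a₁₁ - a₀₀ * q) * (z : ℝ) + (a₁₂ - a₀₁ * q) * (z : ℝ)^2) /
                 ((q⁻¹ - q) * (z : ℝ))) ∧
    (ShatRaise q hq A₁ A₂ ↔
      ∃ a₀₀ a₀₁ a₁₀ a₁₁ a₁₂ : ℝ, ∀ z : Nz,
        A₁ z + A₂ z = a₀₀ + a₀₁ * (z : ℝ) ∧
        q * A₁ z + q⁻¹ * A₂ z = a₁₀ * (z : ℝ)⁻¹ + a₁₁ + a₁₂ * (z : ℝ)) ∧
    Module.finrank ℝ
      ↥(Submodule.span ℝ {P : (Nz → ℝ) × (Nz → ℝ) | ShatRaise q hq P.1 P.2}) = 5 := by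
  refine ⟨raise_iff' q hq hq2 A₁ A₂, raise_iff q hq A₁ A₂, ?_⟩
  rw [raise_set q hq hq2, Submodule.span_eq, LinearMap.finrank_range_of_inj (paramMap_inj q hq hq2)]
  simp
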